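/- Suppose that ρ̂ = ρ + αλ_min − ζ̃_{L*−K} > 0. Then A + D_K is ρ̂-strongly monotone, i.e. ⟪x − y, (u + D_K x) − (v + D_K y)⟫ ≥ ρ̂‖x − y‖² whenever u ∈ A x and v ∈ A y, and the solution set zer(A + C + D_K) = {x ∈ H : 0 ∈ A x + C x + D_K x} is a singleton. -/

import Mathlib

open Filter Topology
open scoped RealInnerProductSpace Pointwise

noncomputable section

variable {H G : Type*}

/-- A set-valued operator `A` is `ρ`-monotone. -/
def IsMonotoneSV [NormedAddCommGroup H] [InnerProductSpace ℝ H]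
    (ρ : ℝ) (A : H → Set H) : Prop :=
  ∀ x y u v, u ∈ A x → v ∈ A y → ρ * ‖x - y‖ ^ 2 ≤ ⟪x - y, u - v⟫

/-- `A` is maximally `ρ`-monotone: it is `ρ`-monotone and its graph is maximal, under
inclusion, among graphs of `ρ`-monotone operators. -/
def IsMaxMonotoneSV [NormedAddCommGroup H] [InnerProductSpace ℝ H]
    (ρ : ℝ) (A : H → Set H) : Prop :=
  IsMonotoneSV ρ A ∧
    ∀ A' : H → Set H, IsMonotoneSV ρ A' → (∀ x, A x ⊆ A' x) → ∀ x, A' x = A x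

/-- `C` is `β`-cocoercive. -/
def IsCocoercive [NormedAddCommGroup H] [InnerProductSpace ℝ H]
    (β : ℝ) (C : H → H) : Prop :=
  ∀ x y, β * ‖C x - C y‖ ^ 2 ≤ ⟪x - y, C x - C y⟫

/-- `k` is a Lipschitz bound for `f`. -/
def IsLipBound {E F : Type*} [NormedAddCommGroup E] [NormedAddCommGroup F]
    (k : ℝ) (f : E → F) : Prop :=
  ∀ x y, ‖f x - f y‖ ≤ k * ‖x - y‖

/-- `k` is the (smallest) Lipschitz constant of `f`. -/
def IsLipConst {E F : Type*} [NormedAddCommGroup E] [NormedAddCommGroup F]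
    (k : ℝ) (f : E → F) : Prop :=
  IsLipBound k f ∧ ∀ k', IsLipBound k' f → k ≤ k'

/-- A single-valued map `B` is monotone. -/
def IsMonotoneMap [NormedAddCommGroup G] [InnerProductSpace ℝ G]
    (B : G → G) : Prop :=
  ∀ x y, (0:ℝ) ≤ ⟪x - y, B x - B y⟫

/-- The operator `D_M : x ↦ α M (L x - c) + M (B (L x))`. -/
def Dop [NormedAddCommGroup H] [InnerProductSpace ℝ H]
    [NormedAddCommGroup G] [InnerProductSpace ℝ G]
    (α : ℝ) (L : H →L[ℝ] G) (c : G) (B : G → G) (M : G →L[ℝ] H) : H → H :=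
  fun x => α • M (L x - c) + M (B (L x))

/-- `λ_min = inf {⟪x, K (L x)⟫ : ‖x‖ = 1}`. -/
def lambdaMin [NormedAddCommGroup H] [InnerProductSpace ℝ H]
    [NormedAddCommGroup G] [InnerProductSpace ℝ G]
    (L : H →L[ℝ] G) (K : G →L[ℝ] H) : ℝ :=
  sInf {r : ℝ | ∃ x : H, ‖x‖ = 1 ∧ r = ⟪x, K (L x)⟫}

/-- The step-size bound `χ`. -/
def chiConst (β ρ κ : ℝ) : ℝ :=
  if 0 ≤ ρ then 4 * β / (1 + Real.sqrt (1 + 16 * β ^ 2 * κ ^ 2))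
  else min (4 * β / (1 + Real.sqrt (1 + 16 * β ^ 2 * κ ^ 2))) (-1 / ρ)


section MonotoneOperators

variable {H G : Type*} [NormedAddCommGroup H] [InnerProductSpace ℝ H]
  [NormedAddCommGroup G] [InnerProductSpace ℝ G]

/-- Monotonicity of a set of pairs extends to the convex hull of its points `(y, v, ⟪y, v⟫)`. -/
lemma inner_le_of_mem_convexHull {S : Set (H × H)}
    (hS : ∀ p ∈ S, ∀ q ∈ S, (0 : ℝ) ≤ ⟪p.1 - q.1, p.2 - q.2⟫) {s : H × H × ℝ}
    (hs : s ∈ convexHull ℝ ((fun p : H × H => (p.1, p.2, (⟪p.1, p.2⟫ : ℝ))) '' S)) :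
    (⟪s.1, s.2.1⟫ : ℝ) ≤ s.2.2 := by
  set Γ := (fun p : H × H => (p.1, p.2, (⟪p.1, p.2⟫ : ℝ))) '' S
  have hconv : ∀ s : H × H × ℝ,
      Convex ℝ {t : H × H × ℝ | 0 ≤ s.2.2 + t.2.2 - ⟪s.1, t.2.1⟫ - ⟪t.1, s.2.1⟫} := by
    intro s t ht t' ht' a b ha hb hab
    simp only [Set.mem_ofPred_eq, Prod.fst_add, Prod.snd_add, Prod.smul_fst, Prod.smul_snd,
      inner_add_left, inner_add_right, real_inner_smul_left, real_inner_smul_right,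
      smul_eq_mul] at ht ht' ⊢
    obtain rfl : b = 1 - a := by linarith
    nlinarith [mul_nonneg ha ht, mul_nonneg hb ht']
  have hgen : ∀ s ∈ Γ, ∀ t ∈ convexHull ℝ Γ,
      0 ≤ s.2.2 + t.2.2 - ⟪s.1, t.2.1⟫ - ⟪t.1, s.2.1⟫ := by
    rintro _ ⟨p, hp, rfl⟩ t ht
    refine convexHull_min ?_ (hconv _) ht
    rintro _ ⟨q, hq, rfl⟩
    have := hS p hp q hq
    simp only [inner_sub_left, inner_sub_right] at this
    simp only [Set.mem_ofPred_eq]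
    linarith
  have hhull : ∀ t ∈ convexHull ℝ Γ, ∀ s ∈ convexHull ℝ Γ,
      0 ≤ t.2.2 + s.2.2 - ⟪t.1, s.2.1⟫ - ⟪s.1, t.2.1⟫ := by
    intro t ht s hs
    refine convexHull_min ?_ (hconv t) hs
    intro r hr
    have := hgen r hr t ht
    simp only [Set.mem_ofPred_eq]
    linarith
  have := hhull s hs s hs
  linarith

/-- A strongly convex quadratic function that is nonnegative on a convex set `S` of pairs `(q, a)`
has an approximate minimizer whose first component satisfies the variational inequality. -/
lemma exists_forall_norm_sq_le_add_inner [CompleteSpace H] {S : Set (H × ℝ)} (hS : Convex ℝ S)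
    (hnn : ∀ s ∈ S, 0 ≤ s.2 + ‖s.1‖ ^ 2 / 4) :
    ∃ x : H, ∀ s ∈ S, ‖x‖ ^ 2 ≤ s.2 + ⟪x, s.1⟫ := by
  rcases S.eq_empty_or_nonempty with rfl | hne
  · exact ⟨0, by simp⟩
  set g : H × ℝ → ℝ := fun s => s.2 + ‖s.1‖ ^ 2 / 4 with hg
  have hbdd : BddBelow (g '' S) := ⟨0, by rintro _ ⟨s, hs, rfl⟩; exact hnn s hs⟩
  set m := sInf (g '' S)
  have hm0 : 0 ≤ m := le_csInf (hne.image g) (by rintro _ ⟨s, hs, rfl⟩; exact hnn s hs)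
  have hm : ∀ s ∈ S, m ≤ g s := fun s hs => csInf_le hbdd ⟨s, hs, rfl⟩
  have hex : ∀ n : ℕ, ∃ s ∈ S, g s < m + 1 / ((n : ℝ) + 1) := by
    intro n
    obtain ⟨_, ⟨s, hs, rfl⟩, h⟩ := exists_lt_of_csInf_lt (hne.image g)
      (show m < m + 1 / ((n : ℝ) + 1) by linarith [Nat.one_div_pos_of_nat (α := ℝ) (n := n)])
    exact ⟨s, hs, h⟩
  choose s hsS hsg using hex
  have hdist : ∀ i j, ‖(s i).1 - (s j).1‖ ^ 2 ≤ 8 * (1 / ((i : ℝ) + 1) + 1 / ((j : ℝ) + 1)) := by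
    intro i j
    have hmid := hm _ (hS (hsS i) (hsS j) (by norm_num : (0 : ℝ) ≤ 1 / 2)
      (by norm_num : (0 : ℝ) ≤ 1 / 2) (by norm_num))
    have hi := hsg i
    have hj := hsg j
    simp only [hg, Prod.fst_add, Prod.snd_add, Prod.smul_fst, Prod.smul_snd, smul_eq_mul,
      ← smul_add, norm_smul, mul_pow] at hmid hi hj
    norm_num at hmid hi hj ⊢
    have hpar := parallelogram_law_with_norm ℝ (s i).1 (s j).1
    nlinarith
  have hcauchy : CauchySeq fun n => (s n).1 := by
    rw [Metric.cauchySeq_iff']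
    intro ε hε
    obtain ⟨N, hN⟩ := exists_nat_one_div_lt (show 0 < ε ^ 2 / 16 by positivity)
    refine ⟨N, fun n hn => ?_⟩
    rw [dist_eq_norm]
    refine lt_of_pow_lt_pow_left₀ 2 hε.le ((hdist n N).trans_lt ?_)
    have := Nat.one_div_le_one_div (α := ℝ) hn
    linarith
  obtain ⟨q, hq⟩ := cauchySeq_tendsto_of_complete hcauchy
  have hgm : Tendsto (fun n => g (s n)) atTop (𝓝 m) := by
    refine tendsto_of_tendsto_of_tendsto_of_le_of_le tendsto_const_nhds ?_
      (fun n => hm _ (hsS n)) (fun n => (hsg n).le)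
    simpa using tendsto_one_div_add_atTop_nhds_zero_nat.const_add m
  have ha : Tendsto (fun n => (s n).2) atTop (𝓝 (m - ‖q‖ ^ 2 / 4)) := by
    have := hgm.sub ((hq.norm.pow 2).div_const 4)
    simpa [hg] using this
  refine ⟨(1 / 2 : ℝ) • q, fun t ht => ?_⟩
  have hvar : ∀ τ : ℝ, 0 < τ → τ < 1 →
      0 ≤ t.2 - (m - ‖q‖ ^ 2 / 4) + ⟪q, t.1 - q⟫ / 2 + τ * (‖t.1 - q‖ ^ 2 / 4) := by
    intro τ h0 h1
    have hlim : Tendsto (fun n => g ((1 - τ) • s n + τ • t)) atTop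
        (𝓝 ((1 - τ) * (m - ‖q‖ ^ 2 / 4) + τ * t.2 + ‖(1 - τ) • q + τ • t.1‖ ^ 2 / 4)) := by
      have hfst := (((hq.const_smul (1 - τ)).add_const (τ • t.1)).norm.pow 2).div_const 4
      exact ((ha.const_mul (1 - τ)).add_const (τ * t.2)).add hfst
    have hle := ge_of_tendsto' hlim fun n =>
      hm _ (hS (hsS n) ht (by linarith : 0 ≤ 1 - τ) h0.le (by ring))
    have heq : (1 - τ) • q + τ • t.1 = q + τ • (t.1 - q) := by module
    rw [heq, norm_add_sq_real, real_inner_smul_right, norm_smul, mul_pow, Real.norm_eq_abs,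
      sq_abs] at hle
    refine nonneg_of_mul_nonneg_right (a := τ) ?_ h0
    linarith
  have hlim : Tendsto (fun τ : ℝ => t.2 - (m - ‖q‖ ^ 2 / 4) + ⟪q, t.1 - q⟫ / 2
      + τ * (‖t.1 - q‖ ^ 2 / 4)) (𝓝[>] 0)
      (𝓝 (t.2 - (m - ‖q‖ ^ 2 / 4) + ⟪q, t.1 - q⟫ / 2 + 0 * (‖t.1 - q‖ ^ 2 / 4))) :=
    (Continuous.tendsto (by fun_prop) 0).mono_left nhdsWithin_le_nhds
  have hfin := ge_of_tendsto hlim <| by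
    filter_upwards [Ioo_mem_nhdsGT (zero_lt_one' ℝ)] with τ hτ using hvar τ hτ.1 hτ.2
  rw [inner_sub_right, real_inner_self_eq_norm_sq] at hfin
  rw [norm_smul, mul_pow, real_inner_smul_left]
  norm_num
  linarith

/-- The key step of Minty's theorem: every monotone set of pairs has a point `(x, -x)` that is
monotonically related to it. -/
lemma exists_forall_inner_nonneg [CompleteSpace H] {S : Set (H × H)}
    (hS : ∀ p ∈ S, ∀ q ∈ S, (0 : ℝ) ≤ ⟪p.1 - q.1, p.2 - q.2⟫) :
    ∃ x : H, ∀ p ∈ S, (0 : ℝ) ≤ ⟪p.1 - x, p.2 + x⟫ := by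
  set Γ := (fun p : H × H => (p.1, p.2, (⟪p.1, p.2⟫ : ℝ))) '' S with hΓ
  let f : H × H × ℝ →ₗ[ℝ] H × ℝ :=
    (LinearMap.fst ℝ H (H × ℝ) - LinearMap.fst ℝ H ℝ ∘ₗ LinearMap.snd ℝ H (H × ℝ)).prod
      (LinearMap.snd ℝ H ℝ ∘ₗ LinearMap.snd ℝ H (H × ℝ))
  obtain ⟨x, hx⟩ := exists_forall_norm_sq_le_add_inner
    (S := f '' convexHull ℝ Γ) ((convex_convexHull ℝ Γ).linear_image f) <| by
      rintro _ ⟨s, hs, rfl⟩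
      have h1 := inner_le_of_mem_convexHull hS hs
      have h2 := norm_add_sq_real s.1 s.2.1
      have h3 := norm_sub_sq_real s.1 s.2.1
      have h4 := sq_nonneg ‖s.1 + s.2.1‖
      change 0 ≤ s.2.2 + ‖s.1 - s.2.1‖ ^ 2 / 4
      linarith
  refine ⟨x, fun p hp => ?_⟩
  have h : ‖x‖ ^ 2 ≤ ⟪p.1, p.2⟫ + ⟪x, p.1 - p.2⟫ :=
    hx _ ⟨_, subset_convexHull ℝ Γ ⟨p, hp, rfl⟩, rfl⟩
  rw [inner_sub_right] at h
  rw [inner_sub_left, inner_add_right, inner_add_right, real_inner_self_eq_norm_sq,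
    real_inner_comm x p.1]
  linarith

lemma IsMaxMonotoneSV.mem_of_forall {ρ : ℝ} {A : H → Set H} (hA : IsMaxMonotoneSV ρ A) {x u : H}
    (h : ∀ y v, v ∈ A y → ρ * ‖x - y‖ ^ 2 ≤ ⟪x - y, u - v⟫) : u ∈ A x := by
  have hmax := hA.2 (fun y => A y ∪ {v | y = x ∧ v = u}) ?_ (fun y => Set.subset_union_left) x
  · rw [← hmax]
    exact Or.inr ⟨rfl, rfl⟩
  · rintro y z v w (hv | ⟨rfl, rfl⟩) (hw | ⟨rfl, rfl⟩)
    · exact hA.1 y z v w hv hw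
    · have := h y v hv
      rwa [← norm_neg, ← inner_neg_neg, neg_sub, neg_sub] at this
    · exact h z w hw
    · simp

/-- Minty's theorem: the resolvent of a maximally `ρ`-monotone operator shifted by `-ρ` is defined
everywhere. -/
lemma IsMaxMonotoneSV.exists_resolvent [CompleteSpace H] {ρ : ℝ} {A : H → Set H}
    (hA : IsMaxMonotoneSV ρ A) {γ : ℝ} (hγ : 0 < γ) (z : H) :
    ∃ x, ρ • x + γ⁻¹ • (z - x) ∈ A x := by
  obtain ⟨x, hx⟩ := exists_forall_inner_nonneg
    (S := {p : H × H | ∃ v ∈ A p.1, p.2 = γ • (v - ρ • p.1) - z}) <| by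
      rintro ⟨y, w⟩ ⟨v, hv, hw⟩ ⟨y', w'⟩ ⟨v', hv', hw'⟩
      obtain rfl : w = γ • (v - ρ • y) - z := hw
      obtain rfl : w' = γ • (v' - ρ • y') - z := hw'
      have h := hA.1 _ _ _ _ hv hv'
      have heq : γ • (v - ρ • y) - z - (γ • (v' - ρ • y') - z)
          = γ • ((v - v') - ρ • (y - y')) := by module
      simp only [heq, real_inner_smul_right, inner_sub_right (y - y') (v - v'),
        real_inner_self_eq_norm_sq]
      exact mul_nonneg hγ.le (by linarith)
  refine ⟨x, hA.mem_of_forall fun y v hv => ?_⟩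
  have h := hx (y, γ • (v - ρ • y) - z) ⟨v, hv, rfl⟩
  have heq : γ • (v - ρ • y) - z + x
      = -(γ • ((ρ • x + γ⁻¹ • (z - x) - v) - ρ • (x - y))) := by
    have : γ • γ⁻¹ • (z - x) = z - x := smul_inv_smul₀ hγ.ne' _
    rw [smul_sub γ (_ - v), smul_sub γ (_ + _), smul_add, this]
    module
  simp only [heq, ← neg_sub x y, inner_neg_neg, real_inner_smul_right] at h
  rw [inner_sub_right, real_inner_smul_right, real_inner_self_eq_norm_sq] at h
  linarith [nonneg_of_mul_nonneg_right h hγ]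

/-- If `A` is maximally `ρ`-monotone and `F` is Lipschitzian such that `F + ρ Id` is strongly
monotone, then `A + F` has a zero. -/
lemma IsMaxMonotoneSV.exists_neg_mem [CompleteSpace H] {ρ : ℝ} {A : H → Set H}
    (hA : IsMaxMonotoneSV ρ A) {F : H → H} {μ ℓ : ℝ} (hμ : 0 < μ)
    (hF : ∀ x y, (μ - ρ) * ‖x - y‖ ^ 2 ≤ ⟪x - y, F x - F y⟫) (hℓ : IsLipBound ℓ F) :
    ∃ x, -F x ∈ A x := by
  set T : H → H := fun x => F x + ρ • x with hT
  set k : ℝ := |ℓ| + |ρ| + μ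
  have hk : 0 < k := by positivity
  have hTlip : ∀ x y, ‖T x - T y‖ ≤ k * ‖x - y‖ := by
    intro x y
    have heq : T x - T y = (F x - F y) + ρ • (x - y) := by simp only [hT]; module
    have h1 := norm_add_le (F x - F y) (ρ • (x - y))
    rw [norm_smul, Real.norm_eq_abs] at h1
    rw [heq]
    have h2 := hℓ x y
    have h3 := mul_le_mul_of_nonneg_right (le_abs_self ℓ) (norm_nonneg (x - y))
    have h4 := mul_nonneg hμ.le (norm_nonneg (x - y))
    simp only [k, add_mul]
    linarith
  have hTmono : ∀ x y, μ * ‖x - y‖ ^ 2 ≤ ⟪x - y, T x - T y⟫ := by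
    intro x y
    have heq : T x - T y = (F x - F y) + ρ • (x - y) := by simp only [hT]; module
    rw [heq, inner_add_right, real_inner_smul_right, real_inner_self_eq_norm_sq]
    linarith [hF x y]
  set γ : ℝ := μ / k ^ 2 with hγdef
  have hγ : 0 < γ := by positivity
  have hγk : γ * k ^ 2 = μ := by rw [hγdef]; field_simp
  have hγμ : γ * μ ≤ 1 := by
    have : μ ≤ k := by simp only [k]; linarith [abs_nonneg ℓ, abs_nonneg ρ]
    rw [hγdef, div_mul_eq_mul_div, div_le_one (by positivity)]
    nlinarith
  choose J hJ using hA.exists_resolvent hγ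
  have hJlip : ∀ z w, ‖J z - J w‖ ≤ ‖z - w‖ := by
    intro z w
    have h := hA.1 _ _ _ _ (hJ z) (hJ w)
    have heq : ρ • J z + γ⁻¹ • (z - J z) - (ρ • J w + γ⁻¹ • (w - J w))
        = ρ • (J z - J w) + γ⁻¹ • ((z - w) - (J z - J w)) := by module
    rw [heq, inner_add_right, real_inner_smul_right, real_inner_smul_right,
      real_inner_self_eq_norm_sq, inner_sub_right _ (z - w), real_inner_self_eq_norm_sq] at h
    have h1 : ‖J z - J w‖ ^ 2 ≤ ⟪J z - J w, z - w⟫ := by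
      linarith [nonneg_of_mul_nonneg_right ((le_add_iff_nonneg_right _).1 h) (inv_pos.2 hγ)]
    have h2 := real_inner_le_norm (J z - J w) (z - w)
    by_contra! h3
    nlinarith [norm_nonneg (z - w)]
  have hstep : ∀ x y, ‖(x - γ • T x) - (y - γ • T y)‖ ≤ √(1 - γ * μ) * ‖x - y‖ := by
    intro x y
    have heq : (x - γ • T x) - (y - γ • T y) = (x - y) - γ • (T x - T y) := by module
    rw [heq, ← Real.sqrt_sq (norm_nonneg (x - y)), ← Real.sqrt_mul (by linarith)]
    refine Real.le_sqrt_of_sq_le ?_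
    rw [norm_sub_sq_real, real_inner_smul_right, norm_smul, mul_pow, Real.norm_eq_abs, sq_abs]
    have h1 := mul_le_mul_of_nonneg_left (hTmono x y) hγ.le
    have h2 := mul_le_mul_of_nonneg_left (pow_le_pow_left₀ (norm_nonneg _) (hTlip x y) 2)
      (sq_nonneg γ)
    have h3 : γ ^ 2 * (k * ‖x - y‖) ^ 2 = γ * μ * ‖x - y‖ ^ 2 := by rw [← hγk]; ring
    linarith
  have hcontr : ContractingWith (√(1 - γ * μ)).toNNReal
      (fun x => J (x - γ • T x)) := by
    refine ⟨?_, LipschitzWith.of_dist_le_mul fun x y => ?_⟩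
    · rw [Real.toNNReal_lt_one, Real.sqrt_lt' one_pos]
      linarith [mul_pos hγ hμ]
    · rw [dist_eq_norm, dist_eq_norm, Real.coe_toNNReal _ (Real.sqrt_nonneg _)]
      exact (hJlip _ _).trans (hstep x y)
  refine ⟨hcontr.fixedPoint, ?_⟩
  have hfix := hcontr.fixedPoint_isFixedPt
  set x := hcontr.fixedPoint
  have hfix' : J (x - γ • T x) = x := hfix
  have h := hJ (x - γ • T x)
  rw [hfix'] at h
  convert h using 1
  rw [sub_sub_cancel_left, smul_neg, inv_smul_smul₀ hγ.ne']
  simp only [hT]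
  module

lemma lambdaMin_mul_norm_sq_le (L : H →L[ℝ] G) (K : G →L[ℝ] H) (z : H) :
    lambdaMin L K * ‖z‖ ^ 2 ≤ ⟪z, K (L z)⟫ := by
  rcases eq_or_ne z 0 with rfl | hz
  · simp
  have hz' : 0 < ‖z‖ := norm_pos_iff.2 hz
  have hbdd : BddBelow {r : ℝ | ∃ x : H, ‖x‖ = 1 ∧ r = ⟪x, K (L x)⟫} := by
    refine ⟨-‖K ∘L L‖, ?_⟩
    rintro _ ⟨x, hx, rfl⟩
    have h1 := neg_le_of_abs_le (abs_real_inner_le_norm x ((K ∘L L) x))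
    have h2 := (K ∘L L).le_opNorm x
    rw [hx] at h1 h2
    simp only [ContinuousLinearMap.comp_apply] at h1 h2
    linarith
  have h := csInf_le hbdd ⟨‖z‖⁻¹ • z, norm_smul_inv_norm (𝕜 := ℝ) hz, rfl⟩
  change lambdaMin L K ≤ _ at h
  simp only [map_smul, real_inner_smul_left, real_inner_smul_right] at h
  calc lambdaMin L K * ‖z‖ ^ 2 ≤ ‖z‖⁻¹ * (‖z‖⁻¹ * ⟪z, K (L z)⟫) * ‖z‖ ^ 2 := by gcongr
    _ = ⟪z, K (L z)⟫ := by field_simp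

lemma Dop_sub_Dop (α : ℝ) (L : H →L[ℝ] G) (c : G) (B : G → G) (K : G →L[ℝ] H) (x y : H) :
    Dop α L c B K x - Dop α L c B K y
      = α • K (L (x - y)) + K (B (L x) - B (L y)) := by
  simp only [Dop, map_sub]
  module

lemma mul_norm_sq_le_inner_Dop [CompleteSpace H] [CompleteSpace G] {α ζt : ℝ} {B : G → G}
    {L : H →L[ℝ] G} {K : G →L[ℝ] H} (c : G) (hB : IsMonotoneMap B) (hα : 0 ≤ α)
    (hζt : IsLipBound ζt (fun x : H => (ContinuousLinearMap.adjoint L - K) (B (L x)))) (x y : H) :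
    (α * lambdaMin L K - ζt) * ‖x - y‖ ^ 2
      ≤ ⟪x - y, Dop α L c B K x - Dop α L c B K y⟫ := by
  rw [Dop_sub_Dop, inner_add_right, real_inner_smul_right]
  have h1 := mul_le_mul_of_nonneg_left (lambdaMin_mul_norm_sq_le L K (x - y)) hα
  have h2 : 0 ≤ ⟪x - y, ContinuousLinearMap.adjoint L (B (L x) - B (L y))⟫ := by
    rw [ContinuousLinearMap.adjoint_inner_right, map_sub]
    exact hB _ _
  have h3 := real_inner_le_norm (x - y)
    ((ContinuousLinearMap.adjoint L - K) (B (L x) - B (L y)))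
  have h4 := hζt x y
  rw [← map_sub] at h4
  have h5 := mul_le_mul_of_nonneg_left h4 (norm_nonneg (x - y))
  rw [sub_apply, inner_sub_right] at h3
  rw [sub_apply] at h5
  linarith

lemma IsLipBound.Dop {α ζ : ℝ} {B : G → G} (hB : IsLipBound ζ B) (hζ : 0 ≤ ζ)
    (L : H →L[ℝ] G) (c : G) (K : G →L[ℝ] H) :
    IsLipBound (|α| * (‖K‖ * ‖L‖) + ‖K‖ * (ζ * ‖L‖)) (Dop α L c B K) := by
  intro x y
  rw [Dop_sub_Dop, add_mul]
  refine (norm_add_le _ _).trans (add_le_add ?_ ?_)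
  · rw [norm_smul, Real.norm_eq_abs, mul_assoc, mul_assoc]
    gcongr
    exact (K.le_opNorm _).trans (by gcongr; exact L.le_opNorm _)
  · rw [mul_assoc, mul_assoc]
    refine (K.le_opNorm _).trans ?_
    gcongr
    refine (hB _ _).trans ?_
    rw [← map_sub]
    gcongr
    exact L.le_opNorm _

lemma IsCocoercive.isLipBound {β : ℝ} {C : H → H} (hC : IsCocoercive β C) (hβ : 0 < β) :
    IsLipBound β⁻¹ C := by
  intro x y
  have h := (hC x y).trans (real_inner_le_norm _ _)
  rw [inv_mul_eq_div, le_div_iff₀ hβ]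
  by_contra! hlt
  have hpos : 0 < ‖C x - C y‖ :=
    pos_of_mul_pos_left ((norm_nonneg _).trans_lt hlt) hβ.le
  nlinarith

end MonotoneOperators

theorem statement2 {H G : Type*} [NormedAddCommGroup H] [InnerProductSpace ℝ H] [CompleteSpace H]
    [NormedAddCommGroup G] [InnerProductSpace ℝ G] [CompleteSpace G]
    (ρ β ζ α : ℝ) (A : H → Set H) (C : H → H) (B : G → G)
    (L : H →L[ℝ] G) (K : G →L[ℝ] H) (c : G)
    (hA : IsMaxMonotoneSV ρ A)
    (hβ : 0 < β) (hC : IsCocoercive β C)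
    (hζ : 0 < ζ) (hBmono : IsMonotoneMap B) (hBlip : IsLipBound ζ B)
    (hα : 0 ≤ α)
    (ζt : ℝ)
    (hζt : IsLipConst ζt (fun x : H => (ContinuousLinearMap.adjoint L - K) (B (L x))))
    (hρhat : 0 < (ρ + α * lambdaMin L K - ζt)) :
    (∀ x y u v, u ∈ A x → v ∈ A y →
        (ρ + α * lambdaMin L K - ζt) * ‖x - y‖ ^ 2 ≤
          ⟪x - y, (u + Dop α L c B K x) - (v + Dop α L c B K y)⟫) ∧
      ∃! z : H, ((0:H) ∈ (fun u => u + C z + Dop α L c B K z) '' A z) := by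
  have hD := mul_norm_sq_le_inner_Dop c hBmono hα hζt.1
  have hCmono : ∀ x y, (0 : ℝ) ≤ ⟪x - y, C x - C y⟫ := fun x y => le_trans (by positivity) (hC x y)
  have hstrong : ∀ x y u v, u ∈ A x → v ∈ A y →
      (ρ + α * lambdaMin L K - ζt) * ‖x - y‖ ^ 2 ≤
        ⟪x - y, (u + Dop α L c B K x) - (v + Dop α L c B K y)⟫ := by
    intro x y u v hu hv
    rw [add_sub_add_comm, inner_add_right]
    linarith [hA.1 x y u v hu hv, hD x y]
  refine ⟨hstrong, ?_⟩
  obtain ⟨z, hz⟩ := hA.exists_neg_mem (F := fun x => C x + Dop α L c B K x) hρhat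
    (ℓ := β⁻¹ + (|α| * (‖K‖ * ‖L‖) + ‖K‖ * (ζ * ‖L‖)))
    (fun x y => by
      rw [add_sub_add_comm, inner_add_right]
      linarith [hCmono x y, hD x y])
    (fun x y => by
      rw [add_sub_add_comm, add_mul]
      exact (norm_add_le _ _).trans
        (add_le_add (hC.isLipBound hβ x y) (hBlip.Dop hζ.le L c K x y)))
  refine ⟨z, ⟨_, hz, by simp only [add_assoc, neg_add_cancel]⟩, ?_⟩
  rintro w ⟨u, hu, hu0⟩
  have h := hstrong w z u _ hu hz
  have heq : u + Dop α L c B K w - (-(C z + Dop α L c B K z) + Dop α L c B K z)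
      = -(C w - C z) := by
    obtain rfl : u = -(C w + Dop α L c B K w) :=
      eq_neg_of_add_eq_zero_left ((add_assoc _ _ _).symm.trans hu0)
    abel
  rw [heq, inner_neg_right] at h
  have hsq : ‖w - z‖ ^ 2 ≤ 0 :=
    nonpos_of_mul_nonpos_right (h.trans (by linarith [hCmono w z])) hρhat
  rwa [sq_nonpos_iff, norm_eq_zero, sub_eq_zero] at hsq
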